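/- arXiv:1912.00545 — 2 statements merged into one kernel-verified Lean document; each statement's English description precedes it below -/
import Mathlib

section
/- For the semi-discrete polygonal area-preserving mean curvature flow, i.e., the semi-discrete polygonal evolution law with edge velocities v_i = −κ_i + (Σ_{j=1}^N κ_j r_j)/L and V_i = (v_i + v_{i+1})/(2 cos(φ_i/2)), one has ∂_t L = (1/L) [ (Σ_{i=1}^N κ_i r_i)² − (Σ_{i=1}^N r_i)(Σ_{i=1}^N κ_i² r_i) ] ≤ 0 (curve-shortening, by the Cauchy–Schwarz inequality), and Σ_{i=1}^N v_i r_i = 0. -/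
open Real

/-- Euclidean norm on the plane `ℝ × ℝ`. -/
noncomputable def norm2 (p : ℝ × ℝ) : ℝ := Real.sqrt (p.1 ^ 2 + p.2 ^ 2)

/-- Rotation by `π/2`: `J(a,b) = (-b,a)`. -/
def Jrot (p : ℝ × ℝ) : ℝ × ℝ := (-p.2, p.1)

/-- Euclidean dot product on the plane `ℝ × ℝ`. -/
def dot (p q : ℝ × ℝ) : ℝ := p.1 * q.1 + p.2 * q.2

theorem sum_sq_pos {p : ℝ × ℝ} (hp : p ≠ 0) : 0 < p.1 ^ 2 + p.2 ^ 2 := by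
  by_contra! h
  have h1 : p.1 = 0 := by nlinarith [sq_nonneg p.1, sq_nonneg p.2]
  have h2 : p.2 = 0 := by nlinarith [sq_nonneg p.1, sq_nonneg p.2]
  exact hp (Prod.ext h1 h2)

/-- The derivative of the length of a nonvanishing plane vector is the component of its velocity
along the unit direction. -/
theorem hasDerivAt_norm2 {f : ℝ → ℝ × ℝ} {f' : ℝ × ℝ} {t : ℝ} (hf : HasDerivAt f f' t)
    (h0 : f t ≠ 0) :
    HasDerivAt (fun s => norm2 (f s)) (dot ((norm2 (f t))⁻¹ • f t) f') t := by
  have h1 : HasDerivAt (fun s => (f s).1) f'.1 t := hf.fst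
  have h2 : HasDerivAt (fun s => (f s).2) f'.2 t := hf.snd
  have h := ((h1.pow 2).add (h2.pow 2)).sqrt (sum_sq_pos h0).ne'
  refine h.congr_deriv ?_
  have hs : √((f t).1 ^ 2 + (f t).2 ^ 2) ≠ 0 := (Real.sqrt_pos.2 (sum_sq_pos h0)).ne'
  simp only [dot, norm2, Prod.smul_fst, Prod.smul_snd, smul_eq_mul, Pi.add_apply,
    Pi.pow_apply]
  field_simp
  simp
  ring

/-- Component, along the direction of angle `β`, of a velocity given in the frame of angle `α`. -/
theorem dot_frame (α β V W : ℝ) :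
    dot (cos β, sin β) (V • -Jrot (cos α, sin α) + W • (cos α, sin α)) =
      V * sin (α - β) + W * cos (α - β) := by
  simp only [dot, Jrot, Prod.smul_mk, Prod.neg_mk, Prod.mk_add_mk, smul_eq_mul, sin_sub, cos_sub]
  ring

theorem dot_sub_right (p q w : ℝ × ℝ) : dot p (q - w) = dot p q - dot p w := by
  simp only [dot, Prod.fst_sub, Prod.snd_sub]
  ring

theorem sum_sub_one {N : ℕ} [NeZero N] (f : ZMod N → ℝ) : ∑ i, f (i - 1) = ∑ i, f i :=
  (Equiv.subRight (1 : ZMod N)).sum_comp f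

/-- Semi-discrete polygonal area-preserving mean curvature flow
(`vᵢ = −κᵢ + (Σ κⱼ rⱼ)/L`): one has
`∂ₜ L = ((Σ κᵢ rᵢ)² − (Σ rᵢ)(Σ κᵢ² rᵢ))/L ≤ 0` and `Σ vᵢ rᵢ = 0`. -/
theorem polygon_apmcf_curve_shortening
    (N : ℕ) [NeZero N] (hN : 3 ≤ N)
    (X : ℝ → ZMod N → ℝ × ℝ)
    (r θ φ V W : ℝ → ZMod N → ℝ)
    (tv nv Tv Nv : ℝ → ZMod N → ℝ × ℝ)
    (hX : ∀ t i, X t i ≠ X t (i - 1))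
    (hr : ∀ t i, r t i = norm2 (X t i - X t (i - 1)))
    (htv : ∀ t i, tv t i = (r t i)⁻¹ • (X t i - X t (i - 1)))
    (hnv : ∀ t i, nv t i = -Jrot (tv t i))
    (hθ : ∀ t i, tv t i = (cos (θ t i), sin (θ t i)))
    (hφmem : ∀ t i, φ t i ∈ Set.Ioo (-π) π)
    (hφ : ∀ t i, tv t (i + 1) = (cos (θ t i + φ t i), sin (θ t i + φ t i)))
    (hTv : ∀ t i, Tv t i = (cos (θ t i + φ t i / 2), sin (θ t i + φ t i / 2)))
    (hNv : ∀ t i, Nv t i = -Jrot (Tv t i))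
    (hevol : ∀ t i, HasDerivAt (fun s => X s i) (V t i • Nv t i + W t i • Tv t i) t)
    (κ v : ℝ → ZMod N → ℝ)
    (hκ : ∀ t i, κ t i = (tan (φ t i / 2) + tan (φ t (i - 1) / 2)) / r t i)
    (hV : ∀ t i, V t i = (v t i + v t (i + 1)) / (2 * cos (φ t i / 2)))
    (hv : ∀ t i, v t i = -κ t i + (∑ j, κ t j * r t j) / (∑ j, r t j))
    (t : ℝ) :
    HasDerivAt (fun s => ∑ i, r s i)
      (((∑ i, κ t i * r t i) ^ 2 - (∑ i, r t i) * ∑ i, (κ t i) ^ 2 * r t i)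
        / (∑ i, r t i)) t
    ∧ ((∑ i, κ t i * r t i) ^ 2 - (∑ i, r t i) * ∑ i, (κ t i) ^ 2 * r t i)
        / (∑ i, r t i) ≤ 0
    ∧ (∑ i, v t i * r t i) = 0 := by
  have hd (i : ZMod N) : X t i - X t (i - 1) ≠ 0 := sub_ne_zero.2 (hX t i)
  have hrpos (i : ZMod N) : 0 < r t i := by
    rw [hr]
    exact Real.sqrt_pos.2 (sum_sq_pos (hd i))
  have hL : 0 < ∑ i, r t i := Finset.sum_pos (fun i _ => hrpos i) Finset.univ_nonempty
  have hcos (i : ZMod N) : cos (φ t i / 2) ≠ 0 := by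
    obtain ⟨h1, h2⟩ := hφmem t i
    exact (cos_pos_of_mem_Ioo ⟨by linarith, by linarith⟩).ne'
  have hedge (i : ZMod N) : HasDerivAt (fun s => r s i)
      (V t i * sin (φ t i / 2) + V t (i - 1) * sin (φ t (i - 1) / 2)
        + (W t i * cos (φ t i / 2) - W t (i - 1) * cos (φ t (i - 1) / 2))) t := by
    have h := hasDerivAt_norm2 ((hevol t i).sub (hevol t (i - 1))) (hd i)
    have hfun : (fun s => r s i) = fun s => norm2 (((fun s => X s i) - fun s => X s (i - 1)) s) :=
      funext fun s => hr s i
    rw [hfun]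
    refine h.congr_deriv ?_
    have hdir : (norm2 (((fun s => X s i) - fun s => X s (i - 1)) t))⁻¹ •
        ((fun s => X s i) - fun s => X s (i - 1)) t = tv t i := by
      rw [htv, hr]
      rfl
    have hprev := hφ t (i - 1)
    rw [sub_add_cancel] at hprev
    rw [hdir, dot_sub_right]
    nth_rewrite 2 [hprev]
    rw [hθ, hNv, hTv, hNv, hTv, dot_frame, dot_frame,
      show θ t i + φ t i / 2 - θ t i = φ t i / 2 by ring,
      show θ t (i - 1) + φ t (i - 1) / 2 - (θ t (i - 1) + φ t (i - 1)) = -(φ t (i - 1) / 2) by ring,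
      sin_neg, cos_neg]
    ring
  have hVsin (i : ZMod N) :
      V t i * sin (φ t i / 2) = (v t i + v t (i + 1)) * tan (φ t i / 2) / 2 := by
    have := hcos i
    rw [hV, tan_eq_sin_div_cos]
    field_simp
  have hκr (i : ZMod N) : tan (φ t i / 2) + tan (φ t (i - 1) / 2) = κ t i * r t i := by
    rw [hκ, div_mul_cancel₀ _ (hrpos i).ne']
  have hvf (f : ZMod N → ℝ) : ∑ i, v t i * f i =
      -∑ i, κ t i * f i + (∑ j, κ t j * r t j) / (∑ j, r t j) * ∑ i, f i := by
    rw [Finset.mul_sum, ← Finset.sum_neg_distrib, ← Finset.sum_add_distrib]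
    refine Finset.sum_congr rfl fun i _ => ?_
    rw [hv]
    ring
  have hshift : ∑ i, v t (i + 1) * tan (φ t i / 2) = ∑ i, v t i * tan (φ t (i - 1) / 2) := by
    rw [← sum_sub_one fun i => v t (i + 1) * tan (φ t i / 2)]
    simp only [sub_add_cancel]
  refine ⟨?_, ?_, ?_⟩
  · refine (HasDerivAt.fun_sum fun i _ => hedge i).congr_deriv ?_
    have hlen : ∑ i, (V t i * sin (φ t i / 2) + V t (i - 1) * sin (φ t (i - 1) / 2)
        + (W t i * cos (φ t i / 2) - W t (i - 1) * cos (φ t (i - 1) / 2)))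
        = ∑ i, v t i * (κ t i * r t i) := by
      rw [Finset.sum_add_distrib, Finset.sum_add_distrib, Finset.sum_sub_distrib,
        sum_sub_one fun i => V t i * sin (φ t i / 2),
        sum_sub_one fun i => W t i * cos (φ t i / 2), sub_self, add_zero]
      simp only [hVsin, ← hκr, mul_add, add_mul, add_div, Finset.sum_add_distrib,
        ← Finset.sum_div, hshift]
      ring
    rw [hlen, hvf]
    simp only [← mul_assoc, ← sq]
    field_simp
    ring
  · refine div_nonpos_of_nonpos_of_nonneg (sub_nonpos.2 ?_) hL.le
    refine Finset.sum_sq_le_sum_mul_sum_of_sq_le_mul _ (fun i _ => (hrpos i).le)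
      (fun i _ => mul_nonneg (sq_nonneg _) (hrpos i).le) fun i _ => le_of_eq ?_
    ring
  · rw [hvf, div_mul_cancel₀ _ hL.ne', neg_add_cancel]
end

section
/- Under the fully discrete polygonal evolution law (X_i − X̂_i)/Δt = V̄_i N̄_i + W̄_i T̄_i with vertex velocities V̄_i = ᾱ_i v̄_i + β̄_i v̄_{i+1} determined by edge velocities v̄_i, if Ḡ_i = 0 for all i, then the change of length satisfies the discrete curve-shortening formula (L − L̂)/Δt = Σ_{i=1}^N κ̄_i v̄_i r̄_i, where κ̄_i = −(F̄_i ᾱ_i + F̄_{i−1} β̄_{i−1})/r̄_i is the fully discrete curvature. -/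
open Real

/-- The squared Euclidean norm is the dot product of a vector with itself. -/
lemma norm2_sq (p : ℝ × ℝ) : norm2 p ^ 2 = dot p p := by
  rw [norm2, Real.sq_sqrt (by positivity), dot]
  ring

lemma norm2_pos {p : ℝ × ℝ} (hp : p ≠ 0) : 0 < norm2 p := by
  apply Real.sqrt_pos.2
  by_contra! h
  apply hp
  ext
  · exact pow_eq_zero_iff two_ne_zero |>.1 (by nlinarith [sq_nonneg p.1, sq_nonneg p.2])
  · exact pow_eq_zero_iff two_ne_zero |>.1 (by nlinarith [sq_nonneg p.1, sq_nonneg p.2])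

/-- A difference of lengths is the dot product of the normalized mean with the difference. -/
lemma norm2_sub_norm2 {p q : ℝ × ℝ} (hp : p ≠ 0) (hq : q ≠ 0) :
    norm2 p - norm2 q = dot ((1 / (norm2 p + norm2 q)) • (p + q)) (p - q) := by
  have hs : norm2 p + norm2 q ≠ 0 := (add_pos (norm2_pos hp) (norm2_pos hq)).ne'
  have hp2 := norm2_sq p
  have hq2 := norm2_sq q
  simp only [dot, Prod.smul_fst, Prod.smul_snd, Prod.fst_add, Prod.snd_add, Prod.fst_sub,
    Prod.snd_sub, smul_eq_mul] at *
  field_simp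
  linear_combination hp2 - hq2

/-- Cyclic summation by parts. -/
lemma sum_dot_sub_pred {N : ℕ} [NeZero N] (D d : ZMod N → ℝ × ℝ) :
    ∑ i, dot (D i) (d i - d (i - 1)) = -∑ i, dot (D (i + 1) - D i) (d i) := by
  have h : ∑ i, dot (D i) (d (i - 1)) = ∑ i, dot (D (i + 1)) (d i) := by
    rw [← Equiv.sum_comp (Equiv.addRight (1 : ZMod N))]
    simp
  have h₁ : ∑ i, dot (D i) (d i - d (i - 1)) =
      ∑ i, dot (D i) (d i) - ∑ i, dot (D i) (d (i - 1)) := by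
    rw [← Finset.sum_sub_distrib]
    refine Finset.sum_congr rfl fun i _ => ?_
    simp only [dot, Prod.fst_sub, Prod.snd_sub]
    ring
  have h₂ : ∑ i, dot (D (i + 1) - D i) (d i) =
      ∑ i, dot (D (i + 1)) (d i) - ∑ i, dot (D i) (d i) := by
    rw [← Finset.sum_sub_distrib]
    refine Finset.sum_congr rfl fun i _ => ?_
    simp only [dot, Prod.fst_sub, Prod.snd_sub]
    ring
  rw [h₁, h₂, h]
  ring

/-- Fully discrete curve-shortening formula: if `Ḡᵢ = 0` for all `i` and
`V̄ᵢ = ᾱᵢ v̄ᵢ + β̄ᵢ v̄ᵢ₊₁`, then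
`(L − L̂)/Δt = Σ κ̄ᵢ v̄ᵢ r̄ᵢ` with `κ̄ᵢ = −(F̄ᵢ ᾱᵢ + F̄ᵢ₋₁ β̄ᵢ₋₁)/r̄ᵢ`. -/
theorem fully_discrete_length_difference_curvature
    (N : ℕ) [NeZero N] (hN : 3 ≤ N)
    (X Xh : ZMod N → ℝ × ℝ)
    (hX : ∀ i, X i ≠ X (i - 1)) (hXh : ∀ i, Xh i ≠ Xh (i - 1))
    (r rh : ZMod N → ℝ)
    (hr : ∀ i, r i = norm2 (X i - X (i - 1)))
    (hrh : ∀ i, rh i = norm2 (Xh i - Xh (i - 1)))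
    (Xb : ZMod N → ℝ × ℝ)
    (hXb : ∀ i, Xb i = (1 / 2 : ℝ) • (X i + Xh i))
    (D : ZMod N → ℝ × ℝ)
    (hD : ∀ i, D i = (2 / (r i + rh i)) • (Xb i - Xb (i - 1)))
    (Δt : ℝ) (hΔt : 0 < Δt)
    (Nb Tb : ZMod N → ℝ × ℝ)
    (hNb : ∀ i, norm2 (Nb i) = 1)
    (hTb : ∀ i, Tb i = Jrot (Nb i))
    (Fb Gb : ZMod N → ℝ)
    (hFG : ∀ i, D (i + 1) - D i = Fb i • Nb i + Gb i • Tb i)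
    (Vb Wb : ZMod N → ℝ)
    (hevol : ∀ i, Δt⁻¹ • (X i - Xh i) = Vb i • Nb i + Wb i • Tb i)
    (rb : ZMod N → ℝ)
    (hrb : ∀ i, rb i = norm2 (Xb i - Xb (i - 1)))
    (hrbne : ∀ i, rb i ≠ 0)
    (α β : ZMod N → ℝ)
    (hα : ∀ i, α i = rb i / (rb i + rb (i + 1)))
    (hβ : ∀ i, β i = rb (i + 1) / (rb i + rb (i + 1)))
    (vb : ZMod N → ℝ)
    (hVb : ∀ i, Vb i = α i * vb i + β i * vb (i + 1))
    (κb : ZMod N → ℝ)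
    (hκb : ∀ i, κb i = -(Fb i * α i + Fb (i - 1) * β (i - 1)) / rb i)
    (hG : ∀ i, Gb i = 0) :
    ((∑ i, r i) - ∑ i, rh i) / Δt = ∑ i, κb i * vb i * rb i := by
  have hlen : ∀ i, r i - rh i = dot (D i) ((X i - Xh i) - (X (i - 1) - Xh (i - 1))) := by
    intro i
    rw [hD, hXb, hXb, hr, hrh, norm2_sub_norm2 (sub_ne_zero.2 (hX i)) (sub_ne_zero.2 (hXh i))]
    simp only [dot, Prod.smul_fst, Prod.smul_snd, Prod.fst_add, Prod.snd_add, Prod.fst_sub,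
      Prod.snd_sub, smul_eq_mul]
    ring
  have hnormal : ∀ i, dot (D (i + 1) - D i) (X i - Xh i) = Δt * (Fb i * Vb i) := by
    intro i
    have hd : X i - Xh i = Δt • (Vb i • Nb i + Wb i • Tb i) := by
      rw [← hevol, smul_inv_smul₀ hΔt.ne']
    have hunit := norm2_sq (Nb i)
    rw [hFG, hd, hG, hTb]
    simp only [hNb, dot, Jrot, Prod.smul_fst, Prod.smul_snd, Prod.fst_add, Prod.snd_add,
      smul_eq_mul] at hunit ⊢
    linear_combination (-(Δt * Fb i * Vb i)) * hunit
  have hshift : ∑ i, Fb (i - 1) * β (i - 1) * vb i = ∑ i, Fb i * β i * vb (i + 1) := by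
    rw [← Equiv.sum_comp (Equiv.addRight (1 : ZMod N))]
    simp
  have hcurv : ∑ i, κb i * vb i * rb i = -∑ i, Fb i * Vb i := by
    calc ∑ i, κb i * vb i * rb i
        = ∑ i, (-(Fb i * α i * vb i) - Fb (i - 1) * β (i - 1) * vb i) := by
          refine Finset.sum_congr rfl fun i _ => ?_
          have := hrbne i
          rw [hκb]
          field_simp
          ring
      _ = ∑ i, (-(Fb i * α i * vb i) - Fb i * β i * vb (i + 1)) := by
          rw [Finset.sum_sub_distrib, Finset.sum_sub_distrib, hshift]
      _ = -∑ i, Fb i * Vb i := by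
          rw [← Finset.sum_neg_distrib]
          refine Finset.sum_congr rfl fun i _ => ?_
          rw [hVb]
          ring
  rw [hcurv, ← Finset.sum_sub_distrib, Finset.sum_congr rfl fun i _ => hlen i,
    sum_dot_sub_pred D fun i => X i - Xh i, Finset.sum_congr rfl fun i _ => hnormal i,
    ← Finset.mul_sum]
  field_simp
end
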